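/- Suppose that A ⊆ G := 𝔽₂ⁿ has density α > 1/2 − ε where ε ∈ (0, 1/(2⁹√n)]. Then A + A contains a coset of a subspace of co-dimension 1, i.e. there is a linear subspace H ≤ G of dimension n − 1 and some x ∈ G such that x + H ⊆ A + A. -/

import Mathlib

open Pointwise

/-- The number of outward edges of `B` at `x` in the hypercube graph, zero when `x ∉ B`. -/
noncomputable def outwardDegree {m : ℕ} (B : Finset (Fin m → ZMod 2)) (x : Fin m → ZMod 2) : ℝ :=
  ∑ i, if x ∈ B ∧ x + Pi.single i 1 ∉ B then 1 else 0

/-- The section of `B` over a value `a` of the first coordinate. -/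
def firstSection {m : ℕ} (B : Finset (Fin (m + 1) → ZMod 2)) (a : ZMod 2) :
    Finset (Fin m → ZMod 2) :=
  {y | Fin.cons a y ∈ B}

lemma mem_firstSection {m : ℕ} {B : Finset (Fin (m + 1) → ZMod 2)} {a : ZMod 2}
    {y : Fin m → ZMod 2} : y ∈ firstSection B a ↔ (Fin.cons a y : Fin (m + 1) → ZMod 2) ∈ B := by
  simp [firstSection]

lemma cons_add_single_zero {m : ℕ} (a c : ZMod 2) (y : Fin m → ZMod 2) :
    (Fin.cons a y + Pi.single 0 c : Fin (m + 1) → ZMod 2) = Fin.cons (a + c) y := by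
  ext j; refine Fin.cases ?_ (fun j => ?_) j <;> simp

lemma cons_add_single_succ {m : ℕ} (a c : ZMod 2) (y : Fin m → ZMod 2) (i : Fin m) :
    (Fin.cons a y + Pi.single i.succ c : Fin (m + 1) → ZMod 2) =
      Fin.cons a (y + Pi.single i c) := by
  ext j; refine Fin.cases ?_ (fun j => ?_) j <;> simp [Pi.single_apply]

lemma sum_cube_succ {m : ℕ} (f : (Fin (m + 1) → ZMod 2) → ℝ) :
    ∑ x, f x =
      ∑ y : Fin m → ZMod 2, f (Fin.cons 0 y) + ∑ y : Fin m → ZMod 2, f (Fin.cons 1 y) := by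
  rw [← (Fin.consEquiv fun _ => ZMod 2).sum_comp, Fintype.sum_prod_type]
  exact Fin.sum_univ_two _

lemma card_eq_sum_ite {α : Type*} [Fintype α] [DecidableEq α] (C : Finset α) :
    (C.card : ℝ) = ∑ x, if x ∈ C then 1 else 0 := by
  simp

lemma card_eq_card_firstSection {m : ℕ} (B : Finset (Fin (m + 1) → ZMod 2)) :
    (B.card : ℝ) = (firstSection B 0).card + (firstSection B 1).card := by
  rw [card_eq_sum_ite, card_eq_sum_ite, card_eq_sum_ite, sum_cube_succ]
  simp only [mem_firstSection]

lemma outwardDegree_nonneg {m : ℕ} (B : Finset (Fin m → ZMod 2)) (x : Fin m → ZMod 2) :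
    0 ≤ outwardDegree B x :=
  Finset.sum_nonneg fun _ _ => by split_ifs <;> norm_num

lemma outwardDegree_le {m : ℕ} (B : Finset (Fin m → ZMod 2)) (x : Fin m → ZMod 2) :
    outwardDegree B x ≤ m := by
  have : outwardDegree B x ≤ ∑ _i : Fin m, (1 : ℝ) :=
    Finset.sum_le_sum fun _ _ => by split_ifs <;> norm_num
  simpa using this

lemma outwardDegree_cons {m : ℕ} (B : Finset (Fin (m + 1) → ZMod 2)) (a : ZMod 2)
    (y : Fin m → ZMod 2) :
    outwardDegree B (Fin.cons a y) = outwardDegree (firstSection B a) y +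
      if y ∈ firstSection B a \ firstSection B (a + 1) then 1 else 0 := by
  simp only [outwardDegree, Fin.sum_univ_succ, cons_add_single_zero, cons_add_single_succ,
    mem_firstSection, Finset.mem_sdiff]
  exact add_comm _ _

lemma sqrt_sum_sq_add_sum_sq_le {ι : Type*} (s : Finset ι) (u v : ι → ℝ) :
    √((∑ i ∈ s, u i) ^ 2 + (∑ i ∈ s, v i) ^ 2) ≤ ∑ i ∈ s, √(u i ^ 2 + v i ^ 2) := by
  have h := norm_sum_le s fun i => (u i + v i * Complex.I : ℂ)
  simp only [Complex.norm_add_mul_I] at h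
  rw [Finset.sum_add_distrib, ← Finset.sum_mul] at h
  rw [← Complex.norm_add_mul_I]
  push_cast
  exact h

/-- The two-point inequality behind the induction, for sections of densities `b ≤ a`. -/
lemma two_point_le {a b P Q S : ℝ} (hb : 0 ≤ b) (hba : b ≤ a) (ha : a ≤ 1)
    (hP : √2 * (a * (1 - a)) ≤ P) (hQ : √2 * (b * (1 - b)) ≤ Q)
    (hS : √(P ^ 2 + (a - b) ^ 2) ≤ S) :
    √2 * ((a + b) / 2 * (1 - (a + b) / 2)) ≤ (S + Q) / 2 := by
  have h2 : √2 ^ 2 = 2 := Real.sq_sqrt (by norm_num)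
  have h0 : 0 ≤ a * (1 - a) := mul_nonneg (by linarith) (by linarith)
  have key : √2 * (a * (1 - a) + (a - b) ^ 2 / 2) ≤ S := by
    refine le_trans (Real.le_sqrt_of_sq_le ?_) hS
    have hP2 : 2 * (a * (1 - a)) ^ 2 ≤ P ^ 2 := by
      have := pow_le_pow_left₀ (by positivity) hP 2
      rwa [mul_pow, h2] at this
    rw [mul_pow, h2]
    have h3 : (a - b) ^ 2 ≤ 1 := by nlinarith
    have h4 : a * (1 - a) ≤ 1 / 4 := by nlinarith [sq_nonneg (a - 1 / 2)]
    nlinarith [mul_nonneg (sq_nonneg (a - b)) (sub_nonneg.2 h4),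
      mul_nonneg (sq_nonneg (a - b)) (sub_nonneg.2 h3)]
  linear_combination key / 2 + hQ / 2

lemma sum_sqrt_outwardDegree_firstSection_ge {m : ℕ} (B : Finset (Fin (m + 1) → ZMod 2))
    (a : ZMod 2) (h : (firstSection B (a + 1)).card ≤ (firstSection B a).card) :
    √((∑ y, √(outwardDegree (firstSection B a) y)) ^ 2 +
        ((firstSection B a).card - (firstSection B (a + 1)).card : ℝ) ^ 2) ≤
      ∑ y, √(outwardDegree B (Fin.cons a y)) := by
  set C := firstSection B a
  set D := firstSection B (a + 1)
  have hcard : (C.card - D.card : ℝ) ≤ ∑ y, if y ∈ C \ D then (1 : ℝ) else 0 := by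
    have h := Finset.le_card_sdiff D C
    have h' : C.card ≤ (C \ D).card + D.card := by omega
    rw [Finset.sum_ite_mem, Finset.univ_inter, Finset.sum_const, nsmul_one, sub_le_iff_le_add]
    exact_mod_cast h'
  have h0 : (0 : ℝ) ≤ C.card - D.card := sub_nonneg.2 (by exact_mod_cast h)
  calc _ ≤ √((∑ y, √(outwardDegree C y)) ^ 2 + (∑ y, if y ∈ C \ D then (1 : ℝ) else 0) ^ 2) := by
        gcongr
    _ ≤ _ := sqrt_sum_sq_add_sum_sq_le _ _ _
    _ = _ := by
        refine Finset.sum_congr rfl fun y _ => ?_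
        rw [outwardDegree_cons, Real.sq_sqrt (outwardDegree_nonneg _ _), ite_pow]
        norm_num [C, D]

lemma density_le_one {m : ℕ} (B : Finset (Fin m → ZMod 2)) : (B.card : ℝ) / 2 ^ m ≤ 1 := by
  rw [div_le_one (by positivity)]
  have := B.card_le_univ
  simp only [Fintype.card_pi, ZMod.card, Finset.prod_const, Finset.card_univ,
    Fintype.card_fin] at this
  exact_mod_cast this

/-- Talagrand's one-sided isoperimetric inequality on the hypercube. -/
theorem density_mul_le_sum_sqrt_outwardDegree {m : ℕ} (B : Finset (Fin m → ZMod 2)) :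
    √2 * ((B.card : ℝ) / 2 ^ m * (1 - B.card / 2 ^ m)) ≤ (∑ x, √(outwardDegree B x)) / 2 ^ m := by
  induction m with
  | zero =>
    have h : B.card ≤ 1 := by simpa using B.card_le_univ
    interval_cases h' : B.card <;> simp
  | succ m ih =>
    have hstep (a : ZMod 2)
        (h : (firstSection B (a + 1)).card ≤ (firstSection B a).card) :
        √2 * (((firstSection B a).card / 2 ^ m + (firstSection B (a + 1)).card / 2 ^ m : ℝ) / 2 *
          (1 - ((firstSection B a).card / 2 ^ m + (firstSection B (a + 1)).card / 2 ^ m : ℝ) / 2)) ≤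
        ((∑ y, √(outwardDegree B (Fin.cons a y))) / 2 ^ m +
          (∑ y, √(outwardDegree B (Fin.cons (a + 1) y))) / 2 ^ m) / 2 := by
      have hQ : (∑ y, √(outwardDegree (firstSection B (a + 1)) y)) / 2 ^ m ≤
          (∑ y, √(outwardDegree B (Fin.cons (a + 1) y))) / 2 ^ m := by
        gcongr with y
        rw [outwardDegree_cons]
        split_ifs <;> linarith
      refine two_point_le (by positivity) (by gcongr) (density_le_one _) (ih _)
        ((ih _).trans hQ) ?_
      rw [le_div_iff₀ (by positivity), ← sub_div, div_pow, div_pow, ← add_div, Real.sqrt_div' _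
        (by positivity), Real.sqrt_sq (by positivity), div_mul_cancel₀ _ (by positivity)]
      exact sum_sqrt_outwardDegree_firstSection_ge B a h
    rw [sum_cube_succ, card_eq_card_firstSection]
    rcases le_total (firstSection B 1).card (firstSection B 0).card with h | h
    · convert hstep 0 (by simpa using h) using 1 <;> simp only [zero_add] <;> ring
    · have h11 : (1 + 1 : ZMod 2) = 0 := rfl
      convert hstep 1 (by simpa [h11] using h) using 1 <;> simp only [h11] <;> ring

/-- Vertex isoperimetry for a pair of sets at Hamming distance at least two. -/
theorem density_mul_le_of_separated {m : ℕ} (X Y : Finset (Fin m → ZMod 2))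
    (hXY : Disjoint X Y) (hsep : ∀ y ∈ Y, ∀ i, y + Pi.single i 1 ∉ X) :
    √2 * ((X.card : ℝ) / 2 ^ m * (1 - X.card / 2 ^ m)) ≤
      √m * (1 - X.card / 2 ^ m - Y.card / 2 ^ m) := by
  have hcompl (Z : Finset (Fin m → ZMod 2)) : (Zᶜ.card : ℝ) = 2 ^ m - Z.card := by
    rw [Finset.card_compl, Nat.cast_sub Z.card_le_univ]
    simp
  have h := density_mul_le_sum_sqrt_outwardDegree Xᶜ
  have hsum : ∑ x, √(outwardDegree Xᶜ x) ≤ ∑ x, if x ∈ (X ∪ Y)ᶜ then √m else 0 := by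
    refine Finset.sum_le_sum fun x _ => ?_
    split_ifs with hx
    · exact Real.sqrt_le_sqrt (outwardDegree_le _ _)
    · have : outwardDegree Xᶜ x = 0 := by
        refine Finset.sum_eq_zero fun i _ => if_neg ?_
        simp only [Finset.mem_compl, Finset.mem_union, not_not] at hx ⊢
        rintro ⟨h1, h2⟩
        exact hsep x (hx.resolve_left h1) i h2
      simp [this]
  rw [Finset.sum_ite_mem, Finset.univ_inter, Finset.sum_const, nsmul_eq_mul, hcompl,
    Finset.card_union_of_disjoint hXY, Nat.cast_add] at hsum
  rw [hcompl] at h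
  have hm : (2 : ℝ) ^ m ≠ 0 := by positivity
  have h' := h.trans (div_le_div_of_nonneg_right hsum (by positivity))
  rw [sub_div, div_self hm, sub_sub_cancel] at h'
  calc _ = √2 * ((1 - X.card / 2 ^ m) * (X.card / 2 ^ m)) := by ring
    _ ≤ _ := h'
    _ = _ := by field_simp; ring

lemma density_le_half_of_disjoint_add {m : ℕ} (X : Finset (Fin m → ZMod 2)) (t : Fin m → ZMod 2)
    (ht : ∀ x ∈ X, x + t ∉ X) : (X.card : ℝ) / 2 ^ m ≤ 1 / 2 := by
  have hd : Disjoint X (X.map (addRightEmbedding t)) := by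
    rw [Finset.disjoint_left]
    intro x hx hx'
    obtain ⟨y, hy, rfl⟩ := Finset.mem_map.1 hx'
    exact ht y hy hx
  have h := density_le_one (X.disjUnion _ hd)
  rw [Finset.card_disjUnion, Finset.card_map, Nat.cast_add, add_div] at h
  linarith

/-- A set avoiding the differences `eᵢ` and some vector of even weight has density bounded away
from `1 / 2` by a multiple of `1 / √n`. -/
theorem density_le_of_even_difference {m : ℕ} (A : Finset (Fin (m + 1) → ZMod 2)) {ε : ℝ}
    (hε₁ : ε ≤ 1 / (2 ^ 9 * √((m + 1 : ℕ) : ℝ)))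
    (he : ∀ a ∈ A, ∀ i, a + Pi.single i 1 ∉ A)
    (s : Fin (m + 1) → ZMod 2) (hs : ∑ i, s i = 0) (hsA : ∀ a ∈ A, a + s ∉ A) :
    (A.card : ℝ) / 2 ^ (m + 1) ≤ 1 / 2 - ε := by
  by_contra! hA
  let Z (c : ZMod 2) : Finset (Fin m → ZMod 2) := {y | Fin.cons (c + ∑ i, y i) y ∈ A}
  have hZ (c : ZMod 2) (y : Fin m → ZMod 2) :
      y ∈ Z c ↔ (Fin.cons (c + ∑ i, y i) y : Fin (m + 1) → ZMod 2) ∈ A := by simp [Z]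
  have hcard : (A.card : ℝ) = (Z 0).card + (Z 1).card := by
    rw [card_eq_sum_ite, card_eq_sum_ite, card_eq_sum_ite, sum_cube_succ, ← Finset.sum_add_distrib, ← Finset.sum_add_distrib]
    refine Finset.sum_congr rfl fun y _ => ?_
    simp only [hZ]
    obtain h | h : ∑ i, y i = 0 ∨ ∑ i, y i = 1 := by
      generalize ∑ i, y i = c
      revert c; decide
    · simp [h]
    · rw [h, add_comm]; rfl
  have hhalf (c : ZMod 2) : ((Z c).card : ℝ) / 2 ^ m ≤ 1 / 2 := by
    refine density_le_half_of_disjoint_add _ (Fin.tail s) fun y hy hy' => ?_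
    rw [hZ] at hy hy'
    refine hsA _ hy ?_
    convert hy' using 1
    rw [Fin.sum_univ_succ, CharTwo.add_eq_zero] at hs
    ext j
    refine Fin.cases ?_ (fun j => ?_) j
    · simp [Finset.sum_add_distrib, hs, Fin.tail, add_assoc]
    · simp [Fin.tail]
  have hdisj : Disjoint (Z 0) (Z 1) := by
    rw [Finset.disjoint_left]
    intro y h0 h1
    rw [hZ] at h0 h1
    refine he _ h0 0 ?_
    rw [cons_add_single_zero]
    convert h1 using 2
    ring
  have hsep : ∀ y ∈ Z 1, ∀ i, y + Pi.single i 1 ∉ Z 0 := by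
    intro y h1 i h0
    rw [hZ] at h0 h1
    refine he _ h1 i.succ ?_
    rw [cons_add_single_succ]
    convert h0 using 2
    simp [Finset.sum_add_distrib, add_comm]
  have hiso := density_mul_le_of_separated _ _ hdisj hsep
  have h0 := hhalf 0
  have h1 := hhalf 1
  have hA' : 1 - 2 * ε < (Z 0).card / 2 ^ m + (Z 1).card / 2 ^ m := by
    rw [hcard, pow_succ, ← div_div, add_div] at hA
    linarith
  set p : ℝ := (Z 0).card / 2 ^ m
  set q : ℝ := (Z 1).card / 2 ^ m
  have hr1 : 1 ≤ √((m + 1 : ℕ) : ℝ) := Real.one_le_sqrt.2 (by simp)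
  have hrm : √(m : ℝ) ≤ √((m + 1 : ℕ) : ℝ) := Real.sqrt_le_sqrt (by simp)
  set r := √((m + 1 : ℕ) : ℝ)
  have hεr : ε * r ≤ 1 / 512 := by
    rw [le_div_iff₀ (by positivity)] at hε₁
    linarith
  have hε : ε ≤ 1 / 512 :=
    hε₁.trans (one_div_le_one_div_of_le (by norm_num) (by linarith))
  have hp : 1 / 4 ≤ p := by linarith
  have hpp : 1 / 8 ≤ p * (1 - p) := by nlinarith
  have h2 : (1 : ℝ) ≤ √2 := Real.one_le_sqrt.2 (by norm_num)
  have hub : √m * (1 - p - q) ≤ 1 / 256 :=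
    calc √m * (1 - p - q) ≤ r * (1 - p - q) :=
          mul_le_mul_of_nonneg_right hrm (by linarith)
      _ ≤ r * (2 * ε) := by gcongr; linarith
      _ ≤ 1 / 256 := by linarith
  nlinarith

lemma finrank_ker_of_ne_zero {n : ℕ} {f : (Fin n → ZMod 2) →ₗ[ZMod 2] ZMod 2} (hf : f ≠ 0) :
    Module.finrank (ZMod 2) (LinearMap.ker f) = n - 1 := by
  have h := Module.Dual.finrank_ker_add_one_of_ne_zero (f := f) hf
  rw [Module.finrank_fin_fun] at h
  omega

/-- If `A ⊆ 𝔽₂ⁿ` has density `> 1/2 - ε` with `ε ∈ (0, 1/(2⁹√n)]`, then `A + A`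
contains a coset of a subspace of co-dimension `1`. -/
theorem sumset_contains_coset_codim_one {n : ℕ} (A : Finset (Fin n → ZMod 2)) (ε : ℝ)
    (hε₀ : 0 < ε) (hε₁ : ε ≤ 1 / (2 ^ 9 * Real.sqrt n))
    (hA : (A.card : ℝ) / 2 ^ n > 1 / 2 - ε) :
    ∃ H : Submodule (ZMod 2) (Fin n → ZMod 2),
      Module.finrank (ZMod 2) H = n - 1 ∧
      ∃ x : Fin n → ZMod 2, ∀ v ∈ H, x + v ∈ A + A := by
  obtain _ | m := n
  · simp only [Nat.cast_zero, Real.sqrt_zero, mul_zero, div_zero] at hε₁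
    exact absurd hε₀ hε₁.not_gt
  by_contra! hno
  let S : Set (Fin (m + 1) → ZMod 2) := {v | v ∉ A + A}
  have hmeet (f : (Fin (m + 1) → ZMod 2) →ₗ[ZMod 2] ZMod 2) (hf : f ≠ 0) (c : ZMod 2) :
      ∃ v ∈ S, f v = c := by
    obtain ⟨x, hx⟩ := LinearMap.surjective hf c
    obtain ⟨v, hv, hv'⟩ := hno _ (finrank_ker_of_ne_zero hf) x
    exact ⟨x + v, hv', by rw [map_add, hx, LinearMap.mem_ker.1 hv, add_zero]⟩
  have hS {v a : Fin (m + 1) → ZMod 2} (hv : v ∈ S) (ha : a ∈ A) : a + v ∉ A := fun h =>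
    hv (Finset.mem_add.2 ⟨a, ha, a + v, h, by rw [← add_assoc, CharTwo.add_self_eq_zero, zero_add]⟩)
  have hspan : ⊤ ≤ Submodule.span (ZMod 2) S := by
    by_contra h
    obtain ⟨f, hf, hle⟩ := Submodule.exists_le_ker_of_lt_top _ (lt_top_iff_ne_top.2 fun h' => h h'.ge)
    obtain ⟨v, hv, hv1⟩ := hmeet f hf 1
    exact one_ne_zero (hv1.symm.trans (hle (Submodule.subset_span hv)))
  let b₀ := Module.Basis.ofSpan hspan
  let b : Module.Basis (Fin (m + 1)) (ZMod 2) (Fin (m + 1) → ZMod 2) :=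
    b₀.reindex (b₀.indexEquiv (Pi.basisFun (ZMod 2) (Fin (m + 1))))
  have hb (i) : b i ∈ S := by
    rw [Module.Basis.reindex_apply]
    exact Module.Basis.ofSpan_subset hspan (Set.mem_range_self _)
  let e := b.equivFun
  have he (i) : e.symm (Pi.single i 1) = b i := by
    rw [LinearEquiv.symm_apply_eq]
    ext j
    simp [e, Pi.single_apply, eq_comm]
  obtain ⟨s, hs, hs0⟩ := hmeet ((∑ i, LinearMap.proj i) ∘ₗ e.toLinearMap) (fun h => by
    have := LinearMap.congr_fun h (b 0)
    simp [e, Finsupp.single_apply] at this) 0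
  refine absurd (density_le_of_even_difference (A.map e.toEquiv.toEmbedding) hε₁ ?_ (e s) ?_ ?_) ?_
  · intro a ha i h
    rw [Finset.mem_map_equiv] at ha h
    refine hS (hb i) ha ?_
    rw [← he]
    simpa using h
  · simpa using hs0
  · intro a ha h
    rw [Finset.mem_map_equiv] at ha h
    refine hS hs ha ?_
    simpa using h
  · rw [Finset.card_map]
    exact not_le.2 hA
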